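/- Suppose m ≡ 0 (mod 4), let K := J_{e_1} ∘ ⋯ ∘ J_{e_m} and W_+ := ker(K - id). Then every Lagrangian subspace L of V decomposes as L = (L ∩ W_+) ⊕ J_{e_m}(W_+ ∩ (L ∩ W_+)^⊥), where (L ∩ W_+)^⊥ is the orthogonal complement in V; moreover L ∩ W_+ is invariant under J_z ∘ J_w for all z, w ∈ ℝ^m. -/

import Mathlib

open RealInnerProductSpace

/-- The standard orthonormal basis vector `e_i` of `ℝ^m`. -/
noncomputable def stdBasis (m : ℕ) (i : Fin m) : EuclideanSpace ℝ (Fin m) :=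
  EuclideanSpace.single i (1 : ℝ)

/-- A subspace `U` is isotropic for the bracket `bra` if the bracket vanishes on `U × U`. -/
def IsotropicSub {V : Type*} [AddCommGroup V] [Module ℝ V] {Z : Type*} [Zero Z]
    (bra : V → V → Z) (U : Submodule ℝ V) : Prop :=
  ∀ u ∈ U, ∀ w ∈ U, bra u w = 0

/-- A subspace is Lagrangian if it is isotropic of dimension half the dimension of `V`. -/
def LagrangianSub {V : Type*} [AddCommGroup V] [Module ℝ V] {Z : Type*} [Zero Z]
    (bra : V → V → Z) (U : Submodule ℝ V) : Prop :=
  IsotropicSub bra U ∧ 2 * Module.finrank ℝ U = Module.finrank ℝ V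


section Helpers

variable {V : Type*} [NormedAddCommGroup V] [InnerProductSpace ℝ V] {m : ℕ}

theorem aux_std_sq (J : EuclideanSpace ℝ (Fin m) →ₗ[ℝ] V →ₗ[ℝ] V)
    (hsq : ∀ (z : EuclideanSpace ℝ (Fin m)) (u : V), J z (J z u) = -(‖z‖ ^ 2) • u) (i : Fin m) :
    J (stdBasis m i) * J (stdBasis m i) = -1 := by
  ext u
  have := hsq (stdBasis m i) u
  simp [stdBasis] at this
  simpa [stdBasis] using this

theorem aux_anti (J : EuclideanSpace ℝ (Fin m) →ₗ[ℝ] V →ₗ[ℝ] V)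
    (hsq : ∀ (z : EuclideanSpace ℝ (Fin m)) (u : V), J z (J z u) = -(‖z‖ ^ 2) • u) (i j : Fin m)
    (hij : i ≠ j) :
    J (stdBasis m i) * J (stdBasis m j) = -(J (stdBasis m j) * J (stdBasis m i)) := by
  ext u
  have h := hsq (stdBasis m i + stdBasis m j) u
  have h1 := hsq (stdBasis m i) u
  have h2 := hsq (stdBasis m j) u
  have h0 : ⟪stdBasis m i, stdBasis m j⟫ = 0 := by
    simp [stdBasis, EuclideanSpace.inner_single_left, hij]
  have hn : ‖stdBasis m i + stdBasis m j‖ ^ 2 = ‖stdBasis m i‖ ^ 2 + ‖stdBasis m j‖ ^ 2 := by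
    rw [norm_add_sq_real, h0]; ring
  rw [hn] at h
  simp only [map_add, LinearMap.add_apply] at h
  rw [h1, h2, neg_add, add_smul] at h
  simp only [Module.End.mul_apply, LinearMap.neg_apply]
  rw [eq_neg_iff_add_eq_zero]
  generalize -‖stdBasis m i‖ ^ 2 • u = a at *
  generalize -‖stdBasis m j‖ ^ 2 • u = b at *
  have h5 := sub_eq_zero.2 h
  rw [← h5]; abel

/-- The product of the operators along a list of indices. -/
noncomputable def prodL (J : EuclideanSpace ℝ (Fin m) →ₗ[ℝ] V →ₗ[ℝ] V) (l : List (Fin m)) :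
    V →ₗ[ℝ] V :=
  (l.map fun i => J (stdBasis m i)).prod

theorem prodL_cons (J : EuclideanSpace ℝ (Fin m) →ₗ[ℝ] V →ₗ[ℝ] V) (a : Fin m)
    (l : List (Fin m)) : prodL J (a :: l) = J (stdBasis m a) * prodL J l := by
  simp [prodL]

theorem prodL_comm (J : EuclideanSpace ℝ (Fin m) →ₗ[ℝ] V →ₗ[ℝ] V)
    (hsq : ∀ (z : EuclideanSpace ℝ (Fin m)) (u : V), J z (J z u) = -(‖z‖ ^ 2) • u) (i : Fin m)
    (l : List (Fin m)) :
    J (stdBasis m i) * prodL J l =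
      ((-1 : ℝ) ^ (l.length + l.count i)) • (prodL J l * J (stdBasis m i)) := by
  induction l with
  | nil => simp [prodL]
  | cons a l ih =>
    rw [prodL_cons]
    by_cases h : a = i
    · subst h
      conv_lhs => rw [ih, mul_smul_comm]
      simp only [List.length_cons, List.count_cons_self]
      rw [show l.length + 1 + (l.count a + 1) = l.length + l.count a + 2 by ring, pow_add _ _ 2]
      rw [neg_one_sq, mul_one, mul_assoc]
    · rw [← mul_assoc, aux_anti J hsq i a (Ne.symm h), neg_mul, mul_assoc, ih, mul_smul_comm]
      simp only [List.length_cons, List.count_cons_of_ne h]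
      rw [show l.length + 1 + l.count i = l.length + l.count i + 1 by ring, pow_succ]
      simp [mul_assoc]

theorem prodL_sq (J : EuclideanSpace ℝ (Fin m) →ₗ[ℝ] V →ₗ[ℝ] V)
    (hsq : ∀ (z : EuclideanSpace ℝ (Fin m)) (u : V), J z (J z u) = -(‖z‖ ^ 2) • u)
    (l : List (Fin m)) (hl : l.Nodup) :
    prodL J l * prodL J l = ((-1 : ℝ) ^ (∑ k ∈ Finset.range (l.length + 1), k)) • 1 := by
  induction l with
  | nil => simp [prodL]
  | cons a l ih =>
    rw [List.nodup_cons] at hl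
    have h := prodL_comm J hsq a l
    rw [List.count_eq_zero_of_not_mem hl.1, add_zero] at h
    have hh : (prodL J l) * J (stdBasis m a) =
        ((-1 : ℝ) ^ l.length) • (J (stdBasis m a) * prodL J l) := by
      rw [h, smul_smul, ← pow_add, Even.neg_one_pow ⟨_, rfl⟩, one_smul]
    rw [prodL_cons, mul_assoc, ← mul_assoc (prodL J l), hh, smul_mul_assoc, mul_smul_comm,
      mul_assoc, ← mul_assoc (J _), aux_std_sq J hsq, ih hl.2, List.length_cons,
      Finset.sum_range_succ _ (l.length + 1)]
    simp only [pow_add, neg_mul, one_mul, pow_one]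
    rw [smul_neg, smul_smul, ← neg_smul]
    congr 1
    ring

theorem prodL_inner (J : EuclideanSpace ℝ (Fin m) →ₗ[ℝ] V →ₗ[ℝ] V)
    (hskew : ∀ (z : EuclideanSpace ℝ (Fin m)) (u w : V), ⟪J z u, w⟫ = -⟪u, J z w⟫)
    (hsq : ∀ (z : EuclideanSpace ℝ (Fin m)) (u : V), J z (J z u) = -(‖z‖ ^ 2) • u)
    (l : List (Fin m)) (u w : V) : ⟪prodL J l u, prodL J l w⟫ = ⟪u, w⟫ := by
  induction l with
  | nil => simp [prodL]
  | cons a l ih =>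
    rw [prodL_cons, Module.End.mul_apply, Module.End.mul_apply, hskew, hsq, ← ih]
    simp [stdBasis]

theorem prodL_mem (J : EuclideanSpace ℝ (Fin m) →ₗ[ℝ] V →ₗ[ℝ] V) (L M : Submodule ℝ V)
    (h1 : ∀ z, ∀ u ∈ L, J z u ∈ M) (h2 : ∀ z, ∀ u ∈ M, J z u ∈ L)
    (l : List (Fin m)) (u : V) (hu : u ∈ L) :
    (Even l.length → prodL J l u ∈ L) ∧ (¬ Even l.length → prodL J l u ∈ M) := by
  induction l with
  | nil => simp [prodL, hu]
  | cons a l ih =>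
    rw [prodL_cons, Module.End.mul_apply, List.length_cons, Nat.even_add_one, not_not]
    exact ⟨fun h => h2 _ _ (ih.2 h), fun h => h1 _ _ (ih.1 h)⟩

end Helpers

theorem stmt_15 {V : Type*} [NormedAddCommGroup V] [InnerProductSpace ℝ V]
    [FiniteDimensional ℝ V] {m : ℕ} (hm : 1 ≤ m)
    (J : EuclideanSpace ℝ (Fin m) →ₗ[ℝ] V →ₗ[ℝ] V)
    (hskew : ∀ (z : EuclideanSpace ℝ (Fin m)) (u w : V), ⟪J z u, w⟫ = -⟪u, J z w⟫)
    (hsq : ∀ (z : EuclideanSpace ℝ (Fin m)) (u : V), J z (J z u) = -(‖z‖ ^ 2) • u)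
    (bra : V → V → EuclideanSpace ℝ (Fin m))
    (hbra : ∀ (z : EuclideanSpace ℝ (Fin m)) (u w : V), ⟪z, bra u w⟫ = ⟪J z u, w⟫)
    (h4 : m % 4 = 0) (K : V →ₗ[ℝ] V)
    (hK : K = (List.ofFn fun i : Fin m => J (stdBasis m i)).prod)
    (L : Submodule ℝ V) (hL : LagrangianSub bra L) :
    L = (L ⊓ LinearMap.ker (K - LinearMap.id)) ⊔
        (LinearMap.ker (K - LinearMap.id) ⊓
          (L ⊓ LinearMap.ker (K - LinearMap.id))ᗮ).map
          (J (stdBasis m ⟨m - 1, by omega⟩)) ∧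
    (L ⊓ LinearMap.ker (K - LinearMap.id)) ⊓
        (LinearMap.ker (K - LinearMap.id) ⊓
          (L ⊓ LinearMap.ker (K - LinearMap.id))ᗮ).map
          (J (stdBasis m ⟨m - 1, by omega⟩)) = ⊥ ∧
    ∀ (z w : EuclideanSpace ℝ (Fin m)),
      ∀ u ∈ L ⊓ LinearMap.ker (K - LinearMap.id),
        J z (J w u) ∈ L ⊓ LinearMap.ker (K - LinearMap.id) := by
  set W := LinearMap.ker (K - LinearMap.id) with hW
  have memW : ∀ u, u ∈ W ↔ K u = u := by
    intro u
    rw [hW, LinearMap.mem_ker, LinearMap.sub_apply, LinearMap.id_apply, sub_eq_zero]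
  have hKl : K = prodL J (List.finRange m) := by
    rw [hK, prodL, List.ofFn_eq_map]
  have heven : Even m := by rw [Nat.even_iff]; omega
  have hKK : ∀ u, K (K u) = u := by
    intro u
    have h := prodL_sq J hsq (List.finRange m) (List.nodup_finRange m)
    rw [← hKl, List.length_finRange, Finset.sum_range_id] at h
    have he : Even ((m + 1) * (m + 1 - 1) / 2) := by
      obtain ⟨k, rfl⟩ : ∃ k, m = 4 * k := ⟨m / 4, by omega⟩
      refine ⟨(4 * k + 1) * k, ?_⟩
      apply Nat.div_eq_of_eq_mul_left (by norm_num)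
      simp only [Nat.add_sub_cancel]
      ring
    rw [he.neg_one_pow, one_smul] at h
    simpa using congrArg (fun f : V →ₗ[ℝ] V => f u) h
  have hKi : ∀ u w, ⟪K u, w⟫ = ⟪u, K w⟫ := by
    intro u w
    conv_lhs => rw [← hKK w]
    have := prodL_inner J hskew hsq (List.finRange m) u (K w)
    rwa [← hKl] at this
  have hKJ : ∀ z u, K (J z u) = -J z (K u) := by
    intro z u
    have hb : ∀ i, K (J (stdBasis m i) u) = -J (stdBasis m i) (K u) := by
      intro i
      have h := prodL_comm J hsq i (List.finRange m)
      rw [← hKl, List.length_finRange, List.count_eq_one_of_mem (List.nodup_finRange m)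
        (List.mem_finRange i), heven.add_one.neg_one_pow] at h
      have h' := congrArg (fun f : V →ₗ[ℝ] V => f u) h
      simp at h'
      rw [h', neg_neg]
    have hz : z = ∑ i, z i • stdBasis m i := by
      ext j
      simp [stdBasis, Finset.sum_apply, Pi.single_apply]
    rw [hz]
    simp only [map_sum, map_smul, LinearMap.sum_apply, LinearMap.smul_apply, hb, smul_neg,
      Finset.sum_neg_distrib]
  have h1 : ∀ z, ∀ u ∈ L, J z u ∈ Lᗮ := by
    intro z u hu
    rw [Submodule.mem_orthogonal']
    intro w hw
    rw [← hbra, hL.1 u hu w hw, inner_zero_right]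
  have h2 : ∀ z, ∀ u ∈ Lᗮ, J z u ∈ L := by
    intro z u hu
    by_cases hz : z = 0
    · simp [hz]
    have hz2 : -(‖z‖ ^ 2) ≠ 0 := by simpa using hz
    have hinj : Function.Injective (J z) := by
      rw [← LinearMap.ker_eq_bot, LinearMap.ker_eq_bot']
      intro v hv
      have := hsq z v
      rw [hv, map_zero] at this
      exact (smul_eq_zero.1 this.symm).resolve_left hz2
    have hmap : L.map (J z) = Lᗮ := by
      apply Submodule.eq_of_le_of_finrank_eq
      · rintro _ ⟨v, hv, rfl⟩
        exact h1 z v hv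
      · rw [← (Submodule.equivMapOfInjective (J z) hinj L).finrank_eq]
        have := L.finrank_add_finrank_orthogonal
        have := hL.2
        omega
    rw [← hmap] at hu
    obtain ⟨v, hv, rfl⟩ := hu
    rw [hsq]
    exact L.smul_mem _ hv
  have hKL : ∀ u ∈ L, K u ∈ L := by
    intro u hu
    rw [hKl]
    exact (prodL_mem J L Lᗮ h1 h2 _ u hu).1 (by simpa using heven)
  generalize hE : stdBasis m ⟨m - 1, by omega⟩ = e
  have hee : ∀ u, J e (J e u) = -u := by
    intro u
    rw [hsq, ← hE]
    simp [stdBasis]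
  refine ⟨le_antisymm ?_ ?_, ?_, ?_⟩
  · intro u hu
    have hd : u = (1 / 2 : ℝ) • (u + K u) + J e (-J e ((1 / 2 : ℝ) • (u - K u))) := by
      rw [map_neg, hee, neg_neg]
      module
    rw [hd]
    have hm1 : (1 / 2 : ℝ) • (u - K u) ∈ L := L.smul_mem _ (L.sub_mem hu (hKL u hu))
    refine Submodule.add_mem_sup ⟨L.smul_mem _ (L.add_mem hu (hKL u hu)), ?_⟩
      (Submodule.mem_map_of_mem ⟨?_, ?_⟩)
    · refine (memW _).2 ?_
      rw [map_smul, map_add, hKK, add_comm]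
    · refine (memW _).2 ?_
      rw [map_neg, hKJ, map_smul, map_sub, hKK, ← map_neg, ← map_neg, ← smul_neg, neg_sub]
      simp only [← map_neg, ← smul_neg, neg_sub]
    · refine Submodule.orthogonal_le inf_le_left ?_
      exact Lᗮ.neg_mem (h1 _ _ hm1)
  · refine sup_le inf_le_left ?_
    rintro _ ⟨u, ⟨huW, hu⟩, rfl⟩
    apply h2
    rw [Submodule.mem_orthogonal']
    intro v hv
    have hp : (1 / 2 : ℝ) • (v + K v) ∈ L ⊓ W := by
      refine ⟨L.smul_mem _ (L.add_mem hv (hKL v hv)), (memW _).2 ?_⟩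
      rw [map_smul, map_add, hKK, add_comm]
    have h := (Submodule.mem_orthogonal' _ _).1 hu _ hp
    rw [inner_smul_right, inner_add_right, ← hKi, (memW u).1 huW] at h
    linarith
  · rw [eq_bot_iff]
    rintro x ⟨⟨-, hx⟩, u, ⟨hu, -⟩, rfl⟩
    have h3 := (memW _).1 hx
    rw [hKJ, (memW u).1 hu] at h3
    rw [Submodule.mem_bot]
    have h5 : J e u = (1 / 2 : ℝ) • (J e u - -J e u) := by module
    rw [h5, h3, sub_self, smul_zero]
  · rintro z w u ⟨hu, huW⟩
    refine ⟨h2 _ _ (h1 _ _ hu), (memW _).2 ?_⟩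
    rw [hKJ, hKJ, map_neg, neg_neg, (memW u).1 huW]
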